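/- For all integers m ≥ 1 and i, j ≥ 2, one has 2 ∫_0^1 r^{2m+3} P_{i−2}^{(1,m+1)}(2r² − 1) P_{j−2}^{(1,m+1)}(2r² − 1) dr = (min(i,j) − 1) / (max(i,j) + m). -/

import Mathlib

open MeasureTheory intervalIntegral

/-- The Jacobi polynomial `P_n^{(1,m+1)}` via the Rodrigues formula
`P_n^{(1,m+1)}(x) = ((−1)ⁿ/(2ⁿ n!)) (1−x)^{−1} (1+x)^{−(m+1)}
  (d/dx)ⁿ [ (1−x)^{n+1} (1+x)^{n+m+1} ]`. -/
noncomputable def jacobi1 (n m : ℕ) (x : ℝ) : ℝ :=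
  ((-1:ℝ)^n / ((2:ℝ)^n * (Nat.factorial n : ℝ))) *
    iteratedDeriv n (fun y : ℝ => (1 - y)^(n + 1) * (1 + y)^(n + m + 1)) x /
      ((1 - x) * (1 + x)^(m + 1))

section JacobiFactor

open Polynomial

/-- The cofactor of `(1 - X)^p (1 + X)^c` in the `k`-th derivative of
`(1 - X)^(p + k) (1 + X)^(c + k)`. -/
noncomputable def jacobiFactor : ℕ → ℕ → ℕ → ℝ[X]
  | _, _, 0 => 1
  | p, c, k + 1 =>
    let V := jacobiFactor (p + 1) (c + 1) k
    (C ((c : ℝ) + 1) * (1 - X) - C ((p : ℝ) + 1) * (1 + X)) * V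
      + (1 - X) * (1 + X) * derivative V

theorem iterate_derivative_eq_jacobiFactor (k p c : ℕ) :
    derivative^[k] ((1 - X : ℝ[X]) ^ (p + k) * (1 + X) ^ (c + k)) =
      (1 - X) ^ p * (1 + X) ^ c * jacobiFactor p c k := by
  induction k generalizing p c with
  | zero => simp [jacobiFactor]
  | succ k ih =>
    rw [Function.iterate_succ_apply', show p + (k + 1) = p + 1 + k by ring,
      show c + (k + 1) = c + 1 + k by ring, ih]
    simp only [jacobiFactor, derivative_mul, derivative_pow_succ, derivative_sub,
      derivative_one, derivative_X, map_add, map_natCast, map_one]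
    ring

theorem natDegree_jacobiFactor_le (k p c : ℕ) : (jacobiFactor p c k).natDegree ≤ k := by
  induction k generalizing p c with
  | zero => simp [jacobiFactor]
  | succ k ih =>
    have h := ih (p + 1) (c + 1)
    have hsub : (1 - X : ℝ[X]).natDegree ≤ 1 := by compute_degree
    have hadd : (1 + X : ℝ[X]).natDegree ≤ 1 := by compute_degree
    simp only [jacobiFactor]
    refine natDegree_add_le_of_degree_le ?_ ?_
    · refine natDegree_mul_le.trans ?_
      have : (C ((c : ℝ) + 1) * (1 - X) - C ((p : ℝ) + 1) * (1 + X)).natDegree ≤ 1 := by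
        compute_degree
      omega
    · rcases Nat.eq_zero_or_pos (jacobiFactor (p + 1) (c + 1) k).natDegree with h0 | h0
      · simp [derivative_of_natDegree_zero h0]
      · refine natDegree_mul_le.trans ?_
        have h1 := natDegree_mul_le (p := (1 - X : ℝ[X])) (q := 1 + X)
        have h2 := natDegree_derivative_le (jacobiFactor (p + 1) (c + 1) k)
        omega

theorem eval_one_jacobiFactor (k p c : ℕ) :
    (jacobiFactor p c k).eval 1 * (p.factorial : ℝ) = (-2) ^ k * ((p + k).factorial : ℝ) := by
  induction k generalizing p c with
  | zero => simp [jacobiFactor]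
  | succ k ih =>
    have h := ih (p + 1) (c + 1)
    rw [Nat.factorial_succ, show p + 1 + k = p + (k + 1) by ring] at h
    push_cast at h
    simp only [jacobiFactor, eval_add, eval_mul, eval_sub, eval_one, eval_X, eval_C]
    rw [pow_succ]
    linear_combination (-2) * h

/-- Integration over `[-1, 1]` as a linear functional on real polynomials. -/
noncomputable def polyIntegral : ℝ[X] →ₗ[ℝ] ℝ where
  toFun q := ∫ x in (-1 : ℝ)..1, q.eval x
  map_add' q r := by
    simp only [eval_add]
    exact integral_add (q.continuous.intervalIntegrable _ _) (r.continuous.intervalIntegrable _ _)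
  map_smul' a q := by simp

theorem polyIntegral_apply (q : ℝ[X]) : polyIntegral q = ∫ x in (-1 : ℝ)..1, q.eval x := rfl

theorem polyIntegral_derivative (q : ℝ[X]) :
    polyIntegral (derivative q) = q.eval 1 - q.eval (-1) :=
  integral_eq_sub_of_hasDerivAt (fun x _ => q.hasDerivAt x)
    ((derivative q).continuous.intervalIntegrable _ _)

theorem polyIntegral_one_add_X_pow (n : ℕ) :
    polyIntegral ((1 + X) ^ n) = 2 ^ (n + 1) / ((n : ℝ) + 1) := by
  have hn : (n : ℝ) + 1 ≠ 0 := by positivity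
  have h := polyIntegral_derivative ((1 + X) ^ (n + 1))
  have hd : derivative ((1 + X : ℝ[X]) ^ (n + 1)) = ((n : ℝ) + 1) • (1 + X) ^ n := by
    rw [derivative_pow_succ, smul_eq_C_mul]
    simp
  rw [hd, map_smul] at h
  norm_num at h
  rw [eq_div_iff hn, mul_comm, h]

theorem polyIntegral_mul_jacobiFactor (k p c : ℕ) :
    polyIntegral ((1 + X) ^ c * jacobiFactor (p + 1) c k) * (p.factorial : ℝ) =
      (-1) ^ k * ((p + k).factorial : ℝ) * (2 ^ (c + k + 1) / ((c : ℝ) + k + 1)) := by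
  induction k generalizing p c with
  | zero => simp [jacobiFactor, polyIntegral_one_add_X_pow, mul_comm]
  | succ k ih =>
    have h := ih (p + 1) (c + 1)
    set V := jacobiFactor (p + 1 + 1) (c + 1) k with hV
    have hd : (1 + X) ^ c * jacobiFactor (p + 1) c (k + 1) =
        derivative ((1 - X) * ((1 + X) ^ (c + 1) * V)) -
          ((p : ℝ) + 1) • ((1 + X) ^ (c + 1) * V) := by
      simp only [jacobiFactor, ← hV, derivative_mul, derivative_pow_succ, derivative_sub,
        derivative_one, derivative_X, map_add, map_natCast, map_one,
        smul_eq_C_mul]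
      push_cast
      ring
    rw [hd, map_sub, map_smul, polyIntegral_derivative]
    rw [Nat.factorial_succ, show p + 1 + k = p + (k + 1) by ring,
      show c + 1 + k = c + (k + 1) by ring] at h
    push_cast at h ⊢
    simp only [eval_mul, eval_sub, eval_add, eval_pow, eval_one, eval_X, smul_eq_mul]
    rw [show (c : ℝ) + (k + 1) + 1 = c + 1 + k + 1 by ring]
    norm_num
    rw [pow_succ (-1 : ℝ) k]
    linear_combination -h

theorem polyIntegral_iterate_derivative_mul_eq_zero (k p c : ℕ) (q : ℝ[X]) (hq : q.degree < k) :
    polyIntegral (derivative^[k] ((1 - X) ^ (p + k) * (1 + X) ^ (c + k)) * q) = 0 := by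
  induction k generalizing p c q with
  | zero =>
    have : q = 0 := by simpa [Nat.WithBot.lt_zero_iff] using hq
    simp [this]
  | succ k ih =>
    rw [Function.iterate_succ_apply', show p + (k + 1) = p + 1 + k by ring,
      show c + (k + 1) = c + 1 + k by ring]
    set D := derivative^[k] ((1 - X : ℝ[X]) ^ (p + 1 + k) * (1 + X) ^ (c + 1 + k)) with hD
    have hdeg : (derivative q).degree < k := by
      rw [degree_lt_iff_coeff_zero] at hq ⊢
      intro n hn
      simp [coeff_derivative, hq (n + 1) (by omega)]
    have hz := ih (p + 1) (c + 1) _ hdeg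
    rw [← hD] at hz
    rw [show derivative D * q = derivative (D * q) - D * derivative q by
      rw [derivative_mul]; ring, map_sub, hz, polyIntegral_derivative, hD,
      iterate_derivative_eq_jacobiFactor]
    simp

theorem polyIntegral_jacobiFactor_mul_jacobiFactor (m : ℕ) {a b : ℕ} (hab : b ≤ a) :
    polyIntegral ((1 + X) ^ (m + 1) * jacobiFactor 1 (m + 1) a * jacobiFactor 1 (m + 1) b) =
      (-2) ^ b * ((b + 1).factorial : ℝ) *
        ((-1) ^ a * (a.factorial : ℝ) * (2 ^ (m + a + 2) / ((m : ℝ) + a + 2))) := by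
  set A := jacobiFactor 1 (m + 1) a with hA
  set B := jacobiFactor 1 (m + 1) b with hB
  have hB1 : B.eval 1 = (-2) ^ b * ((b + 1).factorial : ℝ) := by
    simpa [add_comm] using eval_one_jacobiFactor b 1 (m + 1)
  obtain ⟨g, hg⟩ := X_sub_C_dvd_sub_C_eval (p := B) (a := (1 : ℝ))
  have hgdeg : g.degree < a := by
    by_cases h0 : g = 0
    · simp [h0]
    · have h1 : ((X - C 1) * g : ℝ[X]).natDegree = 1 + g.natDegree := by
        rw [natDegree_mul (X_sub_C_ne_zero 1) h0, natDegree_X_sub_C]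
      have h2 : B.natDegree ≤ b := natDegree_jacobiFactor_le b 1 (m + 1)
      rw [← hg, natDegree_sub_C] at h1
      exact (natDegree_lt_iff_degree_lt h0).1 (by omega)
  have horth := polyIntegral_iterate_derivative_mul_eq_zero a 1 (m + 1) g hgdeg
  rw [iterate_derivative_eq_jacobiFactor, ← hA] at horth
  have hsplit : (1 + X) ^ (m + 1) * A * B = B.eval 1 • ((1 + X) ^ (m + 1) * A) -
      (1 - X) ^ 1 * (1 + X) ^ (m + 1) * A * g := by
    rw [smul_eq_C_mul]
    rw [map_one] at hg
    linear_combination ((1 + X) ^ (m + 1) * A) * hg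
  have hint := polyIntegral_mul_jacobiFactor a 0 (m + 1)
  rw [hsplit, map_sub, map_smul, horth, hB1, smul_eq_mul, sub_zero]
  simp only [Nat.factorial_zero, Nat.cast_one, mul_one, zero_add] at hint
  rw [hA, hint]
  push_cast
  rw [show m + 1 + a + 1 = m + a + 2 by ring, show (m : ℝ) + 1 + a + 1 = m + a + 2 by ring]

theorem iteratedDeriv_eval (q : ℝ[X]) (n : ℕ) :
    iteratedDeriv n (fun y => q.eval y) = fun y => (derivative^[n] q).eval y := by
  induction n with
  | zero => simp
  | succ n ih =>
    rw [iteratedDeriv_succ, ih, Function.iterate_succ_apply']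
    ext y
    exact Polynomial.deriv _

theorem jacobi1_eq_eval_jacobiFactor (n m : ℕ) {x : ℝ} (h₁ : 1 - x ≠ 0) (h₂ : 1 + x ≠ 0) :
    jacobi1 n m x =
      (-1) ^ n / (2 ^ n * (n.factorial : ℝ)) * (jacobiFactor 1 (m + 1) n).eval x := by
  have hW : (fun y : ℝ => (1 - y) ^ (n + 1) * (1 + y) ^ (n + m + 1)) =
      fun y => ((1 - X : ℝ[X]) ^ (1 + n) * (1 + X) ^ (m + 1 + n)).eval y := by
    ext y
    simp only [eval_mul, eval_sub, eval_add, eval_pow, eval_one, eval_X]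
    ring
  rw [jacobi1, hW, iteratedDeriv_eval, iterate_derivative_eq_jacobiFactor]
  simp only [eval_mul, eval_sub, eval_add, eval_pow, eval_one, eval_X, pow_one]
  field_simp

theorem two_mul_integral_eq_polyIntegral (m : ℕ) (q : ℝ[X]) :
    2 * (∫ r in (0 : ℝ)..1, r ^ (2 * m + 3) * q.eval (2 * r ^ 2 - 1)) =
      polyIntegral ((1 + X) ^ (m + 1) * q) / 2 ^ (m + 2) := by
  have hsub := integral_comp_mul_deriv (a := 0) (b := 1) (f := fun r : ℝ => 2 * r ^ 2 - 1)
    (f' := fun r => 4 * r) (g := fun x => ((1 + X) ^ (m + 1) * q).eval x)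
    (fun r _ => by
      refine (((hasDerivAt_pow 2 r).const_mul 2).sub_const 1).congr_deriv ?_
      norm_num [← mul_assoc])
    (by fun_prop) (Polynomial.continuous _)
  norm_num at hsub
  rw [polyIntegral_apply, eq_div_iff (by positivity)]
  simp only [eval_mul, eval_add, eval_pow, eval_one, eval_X]
  rw [← hsub, mul_assoc, mul_comm, mul_assoc, ← intervalIntegral.integral_mul_const]
  refine integral_congr fun r _ => ?_
  simp only [mul_pow, ← pow_mul]
  ring

theorem two_mul_integral_jacobi1_mul_jacobi1 (m : ℕ) {a b : ℕ} (hab : b ≤ a) :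
    2 * (∫ r in (0 : ℝ)..1,
        r ^ (2 * m + 3) * jacobi1 a m (2 * r ^ 2 - 1) * jacobi1 b m (2 * r ^ 2 - 1)) =
      ((b : ℝ) + 1) / ((m : ℝ) + a + 2) := by
  set α : ℝ := (-1) ^ a / (2 ^ a * (a.factorial : ℝ)) with hα
  set β : ℝ := (-1) ^ b / (2 ^ b * (b.factorial : ℝ)) with hβ
  have hcongr : (∫ r in (0 : ℝ)..1,
        r ^ (2 * m + 3) * jacobi1 a m (2 * r ^ 2 - 1) * jacobi1 b m (2 * r ^ 2 - 1)) =
      ∫ r in (0 : ℝ)..1, r ^ (2 * m + 3) *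
        ((α * β) • (jacobiFactor 1 (m + 1) a * jacobiFactor 1 (m + 1) b)).eval
          (2 * r ^ 2 - 1) := by
    refine integral_congr_Ioo_of_le zero_le_one fun r hr => ?_
    have h₁ : 1 - (2 * r ^ 2 - 1) ≠ 0 := by nlinarith [hr.1, hr.2]
    have h₂ : 1 + (2 * r ^ 2 - 1) ≠ 0 := by nlinarith [hr.1, hr.2]
    simp only [jacobi1_eq_eval_jacobiFactor _ m h₁ h₂, eval_smul, eval_mul, smul_eq_mul, ← hα,
      ← hβ]
    ring
  rw [hcongr, two_mul_integral_eq_polyIntegral, mul_smul_comm, map_smul, ← mul_assoc,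
    polyIntegral_jacobiFactor_mul_jacobiFactor m hab, Nat.factorial_succ, hα, hβ, smul_eq_mul,
    neg_pow 2 b]
  have ha : ((-1 : ℝ) ^ a) * (-1) ^ a = 1 := by rw [← mul_pow]; simp
  have hb : ((-1 : ℝ) ^ b) * (-1) ^ b = 1 := by rw [← mul_pow]; simp
  have hm : (m : ℝ) + a + 2 ≠ 0 := by positivity
  push_cast
  rw [show m + a + 2 = a + (m + 2) by ring, pow_add 2 a]
  field_simp
  linear_combination (-1) ^ (2 * b) * ha + hb

end JacobiFactor

/-- for `m ≥ 1` and `i, j ≥ 2`,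
`2 ∫_0^1 r^{2m+3} P_{i−2}^{(1,m+1)}(2r²−1) P_{j−2}^{(1,m+1)}(2r²−1) dr
  = (min(i,j) − 1)/(max(i,j) + m)`. -/
theorem jacobi1_weighted_integral (m i j : ℕ) (hm : 1 ≤ m) (hi : 2 ≤ i) (hj : 2 ≤ j) :
    2 * (∫ r in (0:ℝ)..1,
        r^(2*m + 3) * jacobi1 (i - 2) m (2*r^2 - 1) * jacobi1 (j - 2) m (2*r^2 - 1)) =
      ((min i j : ℝ) - 1) / ((max i j : ℝ) + (m:ℝ)) := by
  obtain ⟨a, rfl⟩ := Nat.exists_eq_add_of_le' hi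
  obtain ⟨b, rfl⟩ := Nat.exists_eq_add_of_le' hj
  simp only [Nat.add_sub_cancel]
  rcases le_total b a with h | h
  · have h' : (b : ℝ) ≤ a := by exact_mod_cast h
    rw [two_mul_integral_jacobi1_mul_jacobi1 m h]
    push_cast
    rw [min_eq_right (by linarith), max_eq_left (by linarith)]
    ring
  · have h' : (a : ℝ) ≤ b := by exact_mod_cast h
    simp only [mul_right_comm _ (jacobi1 a m _)]
    rw [two_mul_integral_jacobi1_mul_jacobi1 m h]
    push_cast
    rw [min_eq_left (by linarith), max_eq_right (by linarith)]
    ring
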